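/- Let a and b be positive coprime squarefree integers with a ≡ b ≡ 1 (mod 4), and let p be an odd prime not dividing ab. Let μ be the additive Haar measure on ℚ_p normalized so that μ(ℤ_p) = 1, and let Ω_p be the set of z ∈ ℚ_p such that az² + b ≠ 0 and v_p(az² + b) is neither equal to 1 nor equal to a negative odd integer. Then the integral over Ω_p of 1 / ( max(|z|_p, 1) · |az² + b|_p^{1/2} ) with respect to μ equals 1 + p^{−1} + (1 + χ_p(−ab))·p^{−3/2}, where χ_p(−ab) denotes the Legendre symbol of −ab modulo p. -/

import Mathlib

open MeasureTheory

/-- Integral of a nonnegative function which is constant on each piece of a countable partition. -/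
lemma integral_iUnion_of_eq_const {X ι : Type*} [MeasurableSpace X] [Countable ι] {μ : Measure X}
    {s : ι → Set X} (hm : ∀ i, MeasurableSet (s i)) (hd : Pairwise (Function.onFun Disjoint s))
    (hfin : ∀ i, μ (s i) ≠ ⊤) {f : X → ℝ} {c : ι → ℝ} (hc : ∀ i, 0 ≤ c i)
    (hf : ∀ i, ∀ x ∈ s i, f x = c i) {S : ℝ} (hS : HasSum (fun i => μ.real (s i) * c i) S) :
    IntegrableOn f (⋃ i, s i) μ ∧ ∫ x in ⋃ i, s i, f x ∂μ = S := by
  have hint : ∀ i, IntegrableOn f (s i) μ := fun i =>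
    (integrableOn_const (hfin i)).congr_fun (fun x hx => (hf i x hx).symm) (hm i)
  have hval : ∀ i, ∫ x in s i, f x ∂μ = μ.real (s i) * c i := fun i => by
    rw [setIntegral_congr_fun (hm i) (hf i), setIntegral_const, smul_eq_mul]
  have hnorm : ∀ i, ∫ x in s i, ‖f x‖ ∂μ = μ.real (s i) * c i := fun i => by
    rw [← hval i]
    exact setIntegral_congr_fun (hm i) fun x hx => by
      simp only [Real.norm_eq_abs, abs_eq_self, hf i x hx, hc i]
  have hI : IntegrableOn f (⋃ i, s i) μ :=
    integrableOn_iUnion_of_summable_integral_norm hint (by simpa only [hnorm] using hS.summable)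
  refine ⟨hI, (hasSum_integral_iUnion hm hd hI).unique ?_⟩
  simpa only [hval] using hS

section Padic

variable {p : ℕ} [hp : Fact p.Prime]

lemma Padic.exists_nat_norm_sub_lt_one {y : ℚ_[p]} (hy : ‖y‖ ≤ 1) :
    ∃ i < p, ‖y - (i : ℚ_[p])‖ < 1 := by
  obtain ⟨x, rfl⟩ : ∃ x : ℤ_[p], (x : ℚ_[p]) = y := ⟨⟨y, hy⟩, rfl⟩
  refine ⟨x.zmodRepr, x.zmodRepr_lt_p, ?_⟩
  exact_mod_cast x.norm_sub_zmodRepr_lt_one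

lemma Padic.valuation_eq_of_norm {x : ℚ_[p]} {n : ℤ} (h : ‖x‖ = (p : ℝ) ^ (-n)) :
    x ≠ 0 ∧ x.valuation = n := by
  have hp1 : (1 : ℝ) < p := mod_cast hp.1.one_lt
  have hx : x ≠ 0 := by
    rintro rfl
    rw [norm_zero] at h
    exact (zpow_pos (by linarith : (0 : ℝ) < p) _).ne h
  refine ⟨hx, ?_⟩
  rw [Padic.norm_eq_zpow_neg_valuation hx] at h
  have := zpow_right_injective₀ (by linarith) hp1.ne' h
  linarith

section Measure

variable [MeasurableSpace ℚ_[p]] [BorelSpace ℚ_[p]] (μ : Measure ℚ_[p]) [μ.IsAddHaarMeasure]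

omit [BorelSpace ℚ_[p]] in
lemma Padic.measure_norm_le_ne_top (t : ℝ) : μ {x : ℚ_[p] | ‖x‖ ≤ t} ≠ ⊤ := by
  have : {x : ℚ_[p] | ‖x‖ ≤ t} = Metric.closedBall 0 t := by ext; simp
  rw [this]
  exact (isCompact_closedBall _ _).measure_lt_top.ne

lemma Padic.measurableSet_norm_le (t : ℝ) : MeasurableSet {x : ℚ_[p] | ‖x‖ ≤ t} :=
  (isClosed_le continuous_norm continuous_const).measurableSet

lemma Padic.measureReal_norm_sub_le (r : ℚ_[p]) (t : ℝ) :
    μ.real {x : ℚ_[p] | ‖x - r‖ ≤ t} = μ.real {x : ℚ_[p] | ‖x‖ ≤ t} := by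
  have : {x : ℚ_[p] | ‖x - r‖ ≤ t} = (fun x => x + -r) ⁻¹' {x : ℚ_[p] | ‖x‖ ≤ t} := by
    ext; simp [sub_eq_add_neg]
  rw [this, measureReal_def, measure_preimage_add_right, measureReal_def]

lemma Padic.measureReal_norm_le_zpow_succ (n : ℤ) :
    μ.real {x : ℚ_[p] | ‖x‖ ≤ (p : ℝ) ^ (n + 1)} = p * μ.real {x : ℚ_[p] | ‖x‖ ≤ (p : ℝ) ^ n} := by
  have hp0 : (0 : ℝ) < p := mod_cast hp.1.pos
  have hpQ : (p : ℚ_[p]) ≠ 0 := mod_cast hp.1.ne_zero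
  set c : ℚ_[p] := (p : ℚ_[p]) ^ (-(n + 1)) with hc
  have hcn : ‖c‖ = (p : ℝ) ^ (n + 1) := by rw [hc, Padic.norm_p_zpow, neg_neg]
  have hc0 : c ≠ 0 := zpow_ne_zero _ hpQ
  have hlt : ∀ y : ℚ_[p], ‖c * y‖ ≤ (p : ℝ) ^ n ↔ ‖y‖ < 1 := fun y => by
    rw [Padic.norm_le_pow_iff_norm_lt_pow_add_one, norm_mul, hcn]
    exact mul_lt_iff_lt_one_right (zpow_pos hp0 _)
  have hset : {x : ℚ_[p] | ‖x‖ ≤ (p : ℝ) ^ (n + 1)} =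
      ⋃ i ∈ Finset.range p, {x : ℚ_[p] | ‖x - c * (i : ℚ_[p])‖ ≤ (p : ℝ) ^ n} := by
    ext x
    obtain ⟨y, rfl⟩ : ∃ y, x = c * y := ⟨c⁻¹ * x, by field_simp⟩
    simp only [Set.mem_ofPred_eq, Set.mem_iUnion, Finset.mem_range, ← mul_sub, hlt, exists_prop]
    rw [norm_mul, hcn, mul_le_iff_le_one_right (zpow_pos hp0 _)]
    refine ⟨Padic.exists_nat_norm_sub_lt_one, ?_⟩
    rintro ⟨i, -, hi⟩
    have h1 := Padic.nonarchimedean (y - (i : ℚ_[p])) i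
    rw [sub_add_cancel] at h1
    exact h1.trans (max_le hi.le (by simpa using Padic.norm_int_le_one (p := p) i))
  have hmeas : ∀ i : ℕ, MeasurableSet {x : ℚ_[p] | ‖x - c * (i : ℚ_[p])‖ ≤ (p : ℝ) ^ n} := fun i =>
    (isClosed_le (by fun_prop) continuous_const).measurableSet
  have hdisj : Set.PairwiseDisjoint (↑(Finset.range p))
      (fun i : ℕ => {x : ℚ_[p] | ‖x - c * (i : ℚ_[p])‖ ≤ (p : ℝ) ^ n}) := by
    intro i hi j hj hij
    refine Set.disjoint_left.2 fun x hx hx' => hij ?_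
    simp only [Set.mem_ofPred_eq, Finset.coe_range, Set.mem_Iio] at hx hx' hi hj
    have h1 : ‖c * ((i : ℤ) - (j : ℤ) : ℤ)‖ ≤ (p : ℝ) ^ n := by
      have h2 := Padic.nonarchimedean (x - c * (j : ℚ_[p])) (-(x - c * (i : ℚ_[p])))
      rw [norm_neg] at h2
      refine le_trans (le_of_eq ?_) (h2.trans (max_le hx' hx))
      congr 1
      push_cast
      ring
    rw [hlt, Padic.norm_intCast_lt_one_iff] at h1
    have h3 := Int.eq_zero_of_abs_lt_dvd h1 (by rw [abs_lt]; omega)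
    omega
  rw [hset, measureReal_biUnion_finset hdisj (fun i _ => hmeas i)
    (fun i _ => by
      have : {x : ℚ_[p] | ‖x - c * (i : ℚ_[p])‖ ≤ (p : ℝ) ^ n} = Metric.closedBall (c * (i : ℚ_[p])) ((p : ℝ) ^ n) := by
        ext; simp [dist_eq_norm]
      rw [this]
      exact (isCompact_closedBall _ _).measure_lt_top.ne)]
  simp [Padic.measureReal_norm_sub_le]

variable {μ}

lemma Padic.measureReal_norm_le_zpow (hμ : μ {x : ℚ_[p] | ‖x‖ ≤ 1} = 1) (n : ℤ) :
    μ.real {x : ℚ_[p] | ‖x‖ ≤ (p : ℝ) ^ n} = (p : ℝ) ^ n := by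
  have hp0 : (p : ℝ) ≠ 0 := mod_cast hp.1.ne_zero
  induction n using Int.induction_on with
  | zero => simp [measureReal_def, hμ]
  | succ n ih => rw [Padic.measureReal_norm_le_zpow_succ, ih, zpow_add_one₀ hp0, mul_comm]
  | pred n ih =>
    have h := Padic.measureReal_norm_le_zpow_succ μ (-(n : ℤ) - 1)
    rw [sub_add_cancel, ih] at h
    refine mul_left_cancel₀ hp0 (h.symm.trans ?_)
    rw [← zpow_one_add₀ hp0]
    congr 1
    ring

end Measure

lemma Padic.norm_eq_zpow_iff {x : ℚ_[p]} {n : ℤ} :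
    ‖x‖ = (p : ℝ) ^ n ↔ ‖x‖ ≤ (p : ℝ) ^ n ∧ ¬ ‖x‖ ≤ (p : ℝ) ^ (n - 1) := by
  rw [← Padic.norm_lt_pow_iff_norm_le_pow_sub_one, not_lt, le_antisymm_iff]

/-- The level sets of a `p`-adic function inside a set of finite measure. -/
lemma Padic.measureReal_norm_eq_zpow [MeasurableSpace ℚ_[p]] [BorelSpace ℚ_[p]] {μ : Measure ℚ_[p]}
    {s : Set ℚ_[p]} (hs : MeasurableSet s) {g : ℚ_[p] → ℚ_[p]} (hg : Continuous g) {n : ℤ}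
    (hfin : μ {z | z ∈ s ∧ ‖g z‖ ≤ (p : ℝ) ^ n} ≠ ⊤) :
    μ.real {z | z ∈ s ∧ ‖g z‖ = (p : ℝ) ^ n} =
      μ.real {z | z ∈ s ∧ ‖g z‖ ≤ (p : ℝ) ^ n} -
        μ.real {z | z ∈ s ∧ ‖g z‖ ≤ (p : ℝ) ^ (n - 1)} := by
  have hp1 : (1 : ℝ) ≤ p := mod_cast hp.1.one_lt.le
  have hset : {z | z ∈ s ∧ ‖g z‖ = (p : ℝ) ^ n} = {z | z ∈ s ∧ ‖g z‖ ≤ (p : ℝ) ^ n} \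
      {z | z ∈ s ∧ ‖g z‖ ≤ (p : ℝ) ^ (n - 1)} := by
    ext z
    simp only [Set.mem_ofPred_eq, Set.mem_sdiff, Padic.norm_eq_zpow_iff]
    tauto
  have hsub : {z | z ∈ s ∧ ‖g z‖ ≤ (p : ℝ) ^ (n - 1)} ⊆ {z | z ∈ s ∧ ‖g z‖ ≤ (p : ℝ) ^ n} :=
    fun z hz => ⟨hz.1, hz.2.trans (zpow_le_zpow_right₀ hp1 (by omega))⟩
  rw [hset, measureReal_sdiff hsub
    (hs.inter (isClosed_le hg.norm continuous_const).measurableSet) hfin]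

/-- An integer prime to the odd prime `p` is a square in `ℚ_[p]` if it is a square modulo `p`. -/
lemma Padic.exists_sq_eq_intCast (hp2 : p ≠ 2) {m : ℤ} (hm : (m : ZMod p) ≠ 0)
    (hsq : IsSquare (m : ZMod p)) : ∃ s : ℚ_[p], s ^ 2 = m := by
  obtain ⟨y, hy⟩ := hsq
  obtain ⟨x, rfl⟩ := ZMod.intCast_surjective y
  have hdvd : (p : ℤ) ∣ x ^ 2 - m := by
    rw [← ZMod.intCast_zmod_eq_zero_iff_dvd]; push_cast; rw [hy]; ring
  have hx : ¬ (p : ℤ) ∣ 2 * x := by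
    intro h
    rcases (Nat.prime_iff_prime_int.1 hp.1).dvd_or_dvd h with h | h
    · have := (Nat.prime_dvd_prime_iff_eq hp.1 Nat.prime_two).1 (by exact_mod_cast h)
      exact hp2 this
    · rw [← ZMod.intCast_zmod_eq_zero_iff_dvd] at h
      rw [hy, h] at hm
      simp at hm
  have h1 : ‖((2 * x : ℤ) : ℤ_[p])‖ = 1 := by
    rw [PadicInt.norm_def, PadicInt.coe_intCast]
    exact le_antisymm (Padic.norm_int_le_one _)
      (not_lt.1 fun h => hx (Padic.norm_intCast_lt_one_iff.1 h))
  have h2 : ‖((x ^ 2 - m : ℤ) : ℤ_[p])‖ < 1 := by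
    rw [PadicInt.norm_def, PadicInt.coe_intCast]
    exact Padic.norm_intCast_lt_one_iff.2 hdvd
  obtain ⟨s, hs, -⟩ := hensels_lemma (p := p) (R := ℤ_[p])
    (F := Polynomial.X ^ 2 - Polynomial.C (m : ℤ_[p])) (a := (x : ℤ_[p])) (by
      push_cast at h1 h2
      simpa [h1, one_add_one_eq_two] using h2)
  refine ⟨s, ?_⟩
  have : s ^ 2 = m := by simpa [sub_eq_zero] using hs
  exact_mod_cast congrArg (Subtype.val) this

lemma Padic.norm_intCast_eq_one {m : ℤ} (hm : ¬ (p : ℤ) ∣ m) : ‖(m : ℚ_[p])‖ = 1 :=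
  le_antisymm (Padic.norm_int_le_one _) (not_lt.1 fun h => hm (Padic.norm_intCast_lt_one_iff.1 h))

lemma Padic.norm_intCast_eq_one_of_not_dvd_mul {a b : ℤ} (hpab : ¬ (p : ℤ) ∣ a * b) :
    ‖(a : ℚ_[p])‖ = 1 ∧ ‖(b : ℚ_[p])‖ = 1 :=
  ⟨Padic.norm_intCast_eq_one fun h => hpab (h.mul_right _),
    Padic.norm_intCast_eq_one fun h => hpab (h.mul_left _)⟩

/-- If `-ab` is not a square modulo `p`, then `az² + b` is a unit for all `p`-adic integers `z`. -/
lemma Padic.not_norm_form_lt_one {a b : ℤ} (hsq : ¬ IsSquare ((-(a * b) : ℤ) : ZMod p))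
    {z : ℚ_[p]} (hz : ‖z‖ ≤ 1) : ¬ ‖(a : ℚ_[p]) * z ^ 2 + (b : ℚ_[p])‖ < 1 := by
  intro h
  obtain ⟨z, rfl⟩ : ∃ x : ℤ_[p], (x : ℚ_[p]) = z := ⟨⟨z, hz⟩, rfl⟩
  have h1 : ‖(a : ℤ_[p]) * z ^ 2 + (b : ℤ_[p])‖ < 1 := by
    rw [PadicInt.norm_def]
    push_cast
    exact h
  have h2 : PadicInt.toZMod ((a : ℤ_[p]) * z ^ 2 + (b : ℤ_[p])) = 0 := by
    rw [← RingHom.mem_ker, PadicInt.ker_toZMod, IsLocalRing.mem_maximalIdeal]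
    exact PadicInt.mem_nonunits.2 h1
  simp only [map_add, map_mul, map_pow, map_intCast] at h2
  refine hsq ⟨a * PadicInt.toZMod z, ?_⟩
  push_cast
  linear_combination (-(a : ZMod p)) * h2

section Form

variable [MeasurableSpace ℚ_[p]] [BorelSpace ℚ_[p]] {μ : Measure ℚ_[p]} [μ.IsAddHaarMeasure]

lemma Padic.measureReal_form_norm_le (hμ : μ {x : ℚ_[p] | ‖x‖ ≤ 1} = 1) (hp2 : p ≠ 2) {a b : ℤ}
    (hpab : ¬ (p : ℤ) ∣ a * b) {n : ℤ} (hn : n ≤ -1) :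
    μ.real {z : ℚ_[p] | ‖z‖ ≤ 1 ∧ ‖(a : ℚ_[p]) * z ^ 2 + (b : ℚ_[p])‖ ≤ (p : ℝ) ^ n} =
      (1 + (legendreSym p (-(a * b)) : ℝ)) * (p : ℝ) ^ n := by
  have hp1 : (1 : ℝ) < p := mod_cast hp.1.one_lt
  have hn1 : (p : ℝ) ^ n < 1 := zpow_lt_one_of_neg₀ hp1 (by omega)
  have hm : ((-(a * b) : ℤ) : ZMod p) ≠ 0 := by
    rwa [Ne, ZMod.intCast_zmod_eq_zero_iff_dvd, dvd_neg]
  obtain ⟨hna, hnb⟩ := Padic.norm_intCast_eq_one_of_not_dvd_mul hpab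
  by_cases hsq : IsSquare ((-(a * b) : ℤ) : ZMod p)
  · rw [(legendreSym.eq_one_iff p hm).2 hsq]
    obtain ⟨s, hs⟩ := Padic.exists_sq_eq_intCast hp2 hm hsq
    have ha0 : (a : ℚ_[p]) ≠ 0 := fun h => by simp [h] at hna
    push_cast at hs
    obtain ⟨r, hr⟩ : ∃ r : ℚ_[p], a * r ^ 2 = -b := ⟨s / a, by
      rw [div_pow, hs]; field_simp⟩
    have hnr : ‖r‖ = 1 := by
      have h := congrArg norm hr
      rw [norm_mul, norm_neg, norm_pow, hna, hnb, one_mul] at h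
      exact (pow_eq_one_iff_of_nonneg (norm_nonneg _) two_ne_zero).1 h
    have hn2 : ‖(2 : ℚ_[p])‖ = 1 := by
      have := Padic.norm_intCast_eq_one (p := p) (m := 2) fun h => hp2
        ((Nat.prime_dvd_prime_iff_eq hp.1 Nat.prime_two).1 (by exact_mod_cast h))
      exact_mod_cast this
    have hn2r : ‖2 * r‖ = 1 := by rw [norm_mul, hn2, hnr, one_mul]
    have hfac : ∀ z : ℚ_[p], ‖(a : ℚ_[p]) * z ^ 2 + (b : ℚ_[p])‖ = ‖z - r‖ * ‖z - -r‖ := fun z => by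
      rw [show (a : ℚ_[p]) * z ^ 2 + (b : ℚ_[p]) = a * ((z - r) * (z - -r)) by
        linear_combination hr, norm_mul, hna, one_mul, norm_mul]
    have hfar : ∀ z : ℚ_[p], ‖z - r‖ < 1 → ‖z - -r‖ = 1 := fun z hz => by
      rw [show z - -r = (z - r) + 2 * r by ring,
        Padic.add_eq_max_of_ne (by rw [hn2r]; exact hz.ne), hn2r, max_eq_right hz.le]
    have hfar' : ∀ z : ℚ_[p], ‖z - -r‖ < 1 → ‖z - r‖ = 1 := fun z hz => by
      rw [show z - r = (z - -r) + -(2 * r) by ring,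
        Padic.add_eq_max_of_ne (by rw [norm_neg, hn2r]; exact hz.ne), norm_neg, hn2r,
        max_eq_right hz.le]
    have hint : ∀ z t : ℚ_[p], ‖t‖ = 1 → ‖z - t‖ ≤ 1 → ‖z‖ ≤ 1 := fun z t ht hz => by
      have h := Padic.nonarchimedean (z - t) t
      rw [sub_add_cancel] at h
      exact h.trans (max_le hz ht.le)
    have hset : {z : ℚ_[p] | ‖z‖ ≤ 1 ∧ ‖(a : ℚ_[p]) * z ^ 2 + (b : ℚ_[p])‖ ≤ (p : ℝ) ^ n} =
        {z : ℚ_[p] | ‖z - r‖ ≤ (p : ℝ) ^ n} ∪ {z : ℚ_[p] | ‖z - -r‖ ≤ (p : ℝ) ^ n} := by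
      ext z
      simp only [Set.mem_ofPred_eq, Set.mem_union, hfac]
      constructor
      · rintro ⟨hz, h⟩
        by_cases hlt : ‖z - r‖ < 1
        · left
          rwa [hfar z hlt, mul_one] at h
        · right
          have h1 : ‖z - r‖ = 1 := by
            refine le_antisymm ?_ (not_lt.1 hlt)
            have h2 := Padic.nonarchimedean z (-r)
            rw [norm_neg, ← sub_eq_add_neg] at h2
            exact h2.trans (max_le hz hnr.le)
          rwa [h1, one_mul] at h
      · rintro (h | h)
        · rw [hfar z (h.trans_lt hn1), mul_one]
          exact ⟨hint z r hnr (h.trans hn1.le), h⟩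
        · rw [hfar' z (h.trans_lt hn1), one_mul]
          exact ⟨hint z (-r) (by rwa [norm_neg]) (h.trans hn1.le), h⟩
    have hdisj : Disjoint {z : ℚ_[p] | ‖z - r‖ ≤ (p : ℝ) ^ n} {z : ℚ_[p] | ‖z - -r‖ ≤ (p : ℝ) ^ n} :=
      Set.disjoint_left.2 fun z hz hz' => by
        simp only [Set.mem_ofPred_eq] at hz hz'
        rw [hfar z (hz.trans_lt hn1)] at hz'
        exact absurd hz' (not_le.2 hn1)
    have hfin : ∀ t : ℚ_[p], μ {z : ℚ_[p] | ‖z - t‖ ≤ (p : ℝ) ^ n} ≠ ⊤ := fun t => by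
      have : {x : ℚ_[p] | ‖x - t‖ ≤ (p : ℝ) ^ n} = Metric.closedBall t ((p : ℝ) ^ n) := by
        ext; simp [dist_eq_norm]
      rw [this]
      exact (isCompact_closedBall _ _).measure_lt_top.ne
    rw [hset, measureReal_union hdisj (isClosed_le (by fun_prop) continuous_const).measurableSet
      (hfin _) (hfin _), Padic.measureReal_norm_sub_le, Padic.measureReal_norm_sub_le,
      Padic.measureReal_norm_le_zpow hμ]
    push_cast
    ring
  · have hset : {z : ℚ_[p] | ‖z‖ ≤ 1 ∧ ‖(a : ℚ_[p]) * z ^ 2 + (b : ℚ_[p])‖ ≤ (p : ℝ) ^ n} = ∅ :=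
      Set.eq_empty_of_forall_notMem fun z hz =>
        Padic.not_norm_form_lt_one hsq hz.1 (hz.2.trans_lt hn1)
    rw [(legendreSym.eq_neg_one_iff p).2 hsq, hset]
    simp

end Form

lemma Padic.norm_form_le_one {a b : ℤ} {z : ℚ_[p]} (hz : ‖z‖ ≤ 1) :
    ‖(a : ℚ_[p]) * z ^ 2 + (b : ℚ_[p])‖ ≤ 1 := by
  refine (Padic.nonarchimedean _ _).trans (max_le ?_ (Padic.norm_int_le_one b))
  rw [norm_mul, norm_pow]
  exact mul_le_one₀ (Padic.norm_int_le_one a) (by positivity) (pow_le_one₀ (norm_nonneg _) hz)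

lemma Padic.norm_form_of_one_lt {a b : ℤ} (ha : ‖(a : ℚ_[p])‖ = 1) {z : ℚ_[p]} (hz : 1 < ‖z‖) :
    ‖(a : ℚ_[p]) * z ^ 2 + (b : ℚ_[p])‖ = ‖z‖ ^ 2 := by
  have h1 : ‖(a : ℚ_[p]) * z ^ 2‖ = ‖z‖ ^ 2 := by rw [norm_mul, ha, one_mul, norm_pow]
  have h2 : ‖(b : ℚ_[p])‖ < ‖z‖ ^ 2 :=
    (Padic.norm_int_le_one b).trans_lt (one_lt_pow₀ hz two_ne_zero)
  rw [Padic.add_eq_max_of_ne (by rw [h1]; exact h2.ne'), h1, max_eq_left h2.le]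

lemma Padic.one_lt_norm_iff {z : ℚ_[p]} : 1 < ‖z‖ ↔ ∃ k : ℕ, ‖z‖ = (p : ℝ) ^ (k + 1 : ℤ) := by
  have hp1 : (1 : ℝ) < p := mod_cast hp.1.one_lt
  refine ⟨fun h => ?_, fun ⟨k, hk⟩ => hk ▸ one_lt_zpow₀ hp1 (by omega)⟩
  have hz : z ≠ 0 := fun h0 => by simp [h0] at h; linarith
  have hv : ¬ 0 ≤ z.valuation := fun h0 => h.not_ge ((Padic.norm_le_one_iff_val_nonneg z).2 h0)
  refine ⟨(-z.valuation - 1).toNat, ?_⟩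
  rw [Padic.norm_eq_zpow_neg_valuation hz]
  congr 1
  omega

/-- Splitting of the domain of integration according to the norms of `z` and `az² + b`. -/
lemma Padic.form_domain_eq {a b : ℤ} (ha : ‖(a : ℚ_[p])‖ = 1) :
    {z : ℚ_[p] | (a : ℚ_[p]) * z ^ 2 + (b : ℚ_[p]) ≠ 0 ∧
        ((a : ℚ_[p]) * z ^ 2 + (b : ℚ_[p])).valuation ≠ 1 ∧
        ¬(((a : ℚ_[p]) * z ^ 2 + (b : ℚ_[p])).valuation < 0 ∧
          Odd (((a : ℚ_[p]) * z ^ 2 + (b : ℚ_[p])).valuation))} =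
      (⋃ k : ℕ, {z : ℚ_[p] | ‖z‖ = (p : ℝ) ^ (k + 1 : ℤ)}) ∪
      ({z : ℚ_[p] | ‖z‖ ≤ 1 ∧ ‖(a : ℚ_[p]) * z ^ 2 + (b : ℚ_[p])‖ = 1} ∪
      ⋃ k : ℕ, {z : ℚ_[p] | ‖z‖ ≤ 1 ∧
        ‖(a : ℚ_[p]) * z ^ 2 + (b : ℚ_[p])‖ = (p : ℝ) ^ (-(k + 2) : ℤ)}) := by
  ext z
  simp only [Set.mem_union, Set.mem_iUnion, Set.mem_ofPred_eq, ← Padic.one_lt_norm_iff]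
  set F : ℚ_[p] := (a : ℚ_[p]) * z ^ 2 + (b : ℚ_[p]) with hF
  constructor
  · rintro ⟨h0, h1, -⟩
    rcases lt_or_ge 1 ‖z‖ with hz | hz
    · exact Or.inl hz
    · have hv := (Padic.norm_le_one_iff_val_nonneg _).1 (Padic.norm_form_le_one (a := a) (b := b) hz)
      rw [← hF] at hv
      have hn := Padic.norm_eq_zpow_neg_valuation h0
      right
      by_cases hv0 : F.valuation = 0
      · exact Or.inl ⟨hz, by rw [hn, hv0]; simp⟩
      · refine Or.inr ⟨(F.valuation - 2).toNat, hz, ?_⟩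
        rw [hn]
        congr 1
        omega
  · rintro (hz | ⟨hz, h⟩ | ⟨k, hz, h⟩)
    · obtain ⟨k, hk⟩ := Padic.one_lt_norm_iff.1 hz
      have hn := Padic.norm_form_of_one_lt (b := b) ha hz
      rw [← hF, hk, ← zpow_natCast, ← zpow_mul, ← neg_neg ((k + 1 : ℤ) * _)] at hn
      obtain ⟨h0, hv⟩ := Padic.valuation_eq_of_norm hn
      refine ⟨h0, by rw [hv]; push_cast; omega, ?_⟩
      rw [hv]
      rintro ⟨-, ho⟩
      refine Int.not_even_iff_odd.2 ho ⟨-(k + 1), ?_⟩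
      push_cast
      ring
    · obtain ⟨h0, hv⟩ := Padic.valuation_eq_of_norm (n := 0) (by simpa using h)
      exact ⟨h0, by omega, by omega⟩
    · obtain ⟨h0, hv⟩ := Padic.valuation_eq_of_norm h
      exact ⟨h0, by omega, by omega⟩

end Padic

/-- Lemma 6.2, the case `p ∤ 2ab`: the non-archimedean local density for the
orbifold `(ℙ¹, ½V(ax² + by²))` equals `1 + p⁻¹ + (1 + (−ab/p)) p^{-3/2}`. -/
theorem sigma_p_binary_form_good_prime (a b : ℤ) (ha : 0 < a) (hb : 0 < b)
    (hab : IsCoprime a b) (hsa : Squarefree a) (hsb : Squarefree b)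
    (ha4 : a % 4 = 1) (hb4 : b % 4 = 1)
    (p : ℕ) [Fact p.Prime] (hp2 : p ≠ 2) (hpab : ¬ (p : ℤ) ∣ a * b)
    [MeasurableSpace ℚ_[p]] [BorelSpace ℚ_[p]]
    (μ : Measure ℚ_[p]) [μ.IsAddHaarMeasure]
    (hμ : μ {x : ℚ_[p] | ‖x‖ ≤ 1} = 1) :
    ∫ z in {z : ℚ_[p] | (a : ℚ_[p]) * z ^ 2 + (b : ℚ_[p]) ≠ 0 ∧
        ((a : ℚ_[p]) * z ^ 2 + (b : ℚ_[p])).valuation ≠ 1 ∧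
        ¬(((a : ℚ_[p]) * z ^ 2 + (b : ℚ_[p])).valuation < 0 ∧
          Odd (((a : ℚ_[p]) * z ^ 2 + (b : ℚ_[p])).valuation))},
      1 / (max ‖z‖ 1 * ‖(a : ℚ_[p]) * z ^ 2 + (b : ℚ_[p])‖ ^ ((1 : ℝ) / 2)) ∂μ
      = 1 + (p : ℝ)⁻¹ + (1 + (legendreSym p (-(a * b)) : ℝ)) * (p : ℝ) ^ (-(3 : ℝ) / 2) := by
  have hp : Fact p.Prime := inferInstance
  have hp1 : (1 : ℝ) < p := mod_cast hp.1.one_lt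
  have hp0 : (0 : ℝ) < p := by linarith
  obtain ⟨hna, -⟩ := Padic.norm_intCast_eq_one_of_not_dvd_mul hpab
  rw [Padic.form_domain_eq hna]
  set χ : ℝ := (legendreSym p (-(a * b)) : ℝ) with hχ
  obtain ⟨q, hq0, hq⟩ : ∃ q : ℝ, 0 < q ∧ (p : ℝ) ^ (-(3 : ℝ) / 2) = q ^ 3 ∧ (p : ℝ) = (q ^ 2)⁻¹ := by
    refine ⟨(p : ℝ) ^ (-(1 : ℝ) / 2), by positivity, ?_, ?_⟩
    · rw [← Real.rpow_natCast, ← Real.rpow_mul hp0.le]; norm_num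
    · rw [← Real.rpow_natCast, ← Real.rpow_mul hp0.le]; norm_num [Real.rpow_neg_one]
  obtain ⟨hq3, hpq⟩ := hq
  have hq1 : q < 1 := by
    by_contra h
    have : (1 : ℝ) ≤ q ^ 2 := one_le_pow₀ (not_lt.1 h)
    exact hp1.not_ge (hpq ▸ inv_le_one_of_one_le₀ this)
  have hsqrt : ∀ n : ℤ, ((p : ℝ) ^ n) ^ ((1 : ℝ) / 2) = q ^ (-n) := fun n => by
    rw [← Real.sqrt_eq_rpow, show (p : ℝ) ^ n = (q ^ (-n)) ^ 2 by
      rw [hpq, inv_zpow', ← zpow_natCast, ← zpow_natCast, ← zpow_mul, ← zpow_mul, mul_comm],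
      Real.sqrt_sq (zpow_pos hq0 _).le]
  set f : ℚ_[p] → ℝ := fun z =>
    1 / (max ‖z‖ 1 * ‖(a : ℚ_[p]) * z ^ 2 + (b : ℚ_[p])‖ ^ ((1 : ℝ) / 2)) with hf
  have hcont : Continuous fun z : ℚ_[p] => (a : ℚ_[p]) * z ^ 2 + (b : ℚ_[p]) := by fun_prop
  have hunit : MeasurableSet {z : ℚ_[p] | ‖z‖ ≤ 1} := Padic.measurableSet_norm_le 1
  have hinj : Function.Injective fun n : ℤ => (p : ℝ) ^ n := zpow_right_injective₀ hp0 hp1.ne'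
  have hfin : ∀ P : ℚ_[p] → Prop, μ {z : ℚ_[p] | ‖z‖ ≤ 1 ∧ P z} ≠ ⊤ := fun P =>
    measure_ne_top_of_subset (fun z hz => hz.1) (Padic.measure_norm_le_ne_top μ 1)
  have hmeas : ∀ t : ℝ, MeasurableSet
      {z : ℚ_[p] | ‖z‖ ≤ 1 ∧ ‖(a : ℚ_[p]) * z ^ 2 + (b : ℚ_[p])‖ = t} := fun t =>
    hunit.inter (isClosed_eq hcont.norm continuous_const).measurableSet
  have houtmeas : ∀ k : ℕ, MeasurableSet {z : ℚ_[p] | ‖z‖ = (p : ℝ) ^ (k + 1 : ℤ)} := fun k =>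
    (isClosed_eq continuous_norm continuous_const).measurableSet
  have hlevel : ∀ n : ℤ, n ≤ -1 →
      μ.real {z : ℚ_[p] | ‖z‖ ≤ 1 ∧ ‖(a : ℚ_[p]) * z ^ 2 + (b : ℚ_[p])‖ = (p : ℝ) ^ n} =
        (1 + χ) * ((p : ℝ) ^ n - (p : ℝ) ^ (n - 1)) := fun n hn => by
    have h := Padic.measureReal_norm_eq_zpow (μ := μ) hunit hcont (n := n) (hfin _)
    simp only [Set.mem_ofPred_eq] at h
    rw [h, Padic.measureReal_form_norm_le hμ hp2 hpab hn,
      Padic.measureReal_form_norm_le hμ hp2 hpab (by omega)]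
    ring
  have hshell : ∀ n : ℤ, μ.real {z : ℚ_[p] | ‖z‖ = (p : ℝ) ^ n} =
      (p : ℝ) ^ n - (p : ℝ) ^ (n - 1) := fun n => by
    have h := Padic.measureReal_norm_eq_zpow (μ := μ) MeasurableSet.univ continuous_id (n := n)
      (by simpa using Padic.measure_norm_le_ne_top μ ((p : ℝ) ^ n))
    simp only [Set.mem_univ, true_and, id_eq] at h
    rw [h, Padic.measureReal_norm_le_zpow hμ, Padic.measureReal_norm_le_zpow hμ]
  have hzero : μ.real {z : ℚ_[p] | ‖z‖ ≤ 1 ∧ ‖(a : ℚ_[p]) * z ^ 2 + (b : ℚ_[p])‖ = 1} =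
      1 - (1 + χ) * q ^ 2 := by
    have h := Padic.measureReal_norm_eq_zpow (μ := μ) hunit hcont (n := 0) (hfin _)
    simp only [Set.mem_ofPred_eq, zpow_zero] at h
    have hall : {z : ℚ_[p] | ‖z‖ ≤ 1 ∧ ‖(a : ℚ_[p]) * z ^ 2 + (b : ℚ_[p])‖ ≤ 1} =
        {z : ℚ_[p] | ‖z‖ ≤ 1} :=
      Set.ext fun z => and_iff_left_of_imp Padic.norm_form_le_one
    rw [h, Padic.measureReal_form_norm_le hμ hp2 hpab (by omega), hall, measureReal_def, hμ,
      ← hχ, hpq]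
    simp
  have hout := integral_iUnion_of_eq_const (μ := μ) (f := f)
    (s := fun k : ℕ => {z : ℚ_[p] | ‖z‖ = (p : ℝ) ^ (k + 1 : ℤ)})
    (c := fun k : ℕ => q ^ (4 * (k + 1))) (S := q ^ 2) houtmeas
    (fun i j hij => Set.disjoint_left.2 fun z (hz : _ = _) (hz' : _ = _) => hij (by
      have := hinj (hz.symm.trans hz')
      omega))
    (fun k => measure_ne_top_of_subset (fun z (hz : _ = _) => hz.le)
      (Padic.measure_norm_le_ne_top μ _))
    (fun k => by positivity)
    (fun k z (hz : _ = _) => by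
      have hz1 := Padic.one_lt_norm_iff.2 ⟨k, hz⟩
      simp only [hf]
      rw [Padic.norm_form_of_one_lt hna hz1, max_eq_left hz1.le, ← Real.sqrt_eq_rpow,
        Real.sqrt_sq (norm_nonneg _), hz, hpq]
      norm_cast
      simp only [inv_pow, ← pow_mul, one_div, mul_inv, inv_inv, ← pow_add]
      congr 1
      ring)
    (by
      have hg := (hasSum_geometric_of_lt_one (sq_nonneg q)
        (pow_lt_one₀ hq0.le hq1 two_ne_zero)).mul_left ((1 - q ^ 2) * q ^ 2)
      have h1 : (1 : ℝ) - q ^ 2 ≠ 0 := (sub_pos.2 (pow_lt_one₀ hq0.le hq1 two_ne_zero)).ne'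
      rw [show (1 - q ^ 2) * q ^ 2 * (1 - q ^ 2)⁻¹ = q ^ 2 by field_simp] at hg
      refine Eq.mpr (congrArg (fun g : ℕ → ℝ => HasSum g _) (funext fun k => ?_)) hg
      rw [hshell, add_sub_cancel_right, hpq]
      norm_cast
      simp only [inv_pow, ← pow_mul]
      field_simp
      ring)
  have hin := integral_iUnion_of_eq_const (μ := μ) (f := f)
    (s := fun k : ℕ => {z : ℚ_[p] | ‖z‖ ≤ 1 ∧
      ‖(a : ℚ_[p]) * z ^ 2 + (b : ℚ_[p])‖ = (p : ℝ) ^ (-(k + 2) : ℤ)})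
    (c := fun k : ℕ => (q ^ (k + 2))⁻¹) (S := (1 + χ) * (1 + q) * q ^ 2) (fun k => hmeas _)
    (fun i j hij => Set.disjoint_left.2 fun z hz hz' => hij (by
      have := hinj (hz.2.symm.trans hz'.2)
      omega))
    (fun k => hfin _)
    (fun k => by positivity)
    (fun k z hz => by
      simp only [hf]
      rw [hz.2, max_eq_right hz.1, hsqrt, neg_neg, one_mul, one_div]
      norm_cast)
    (by
      have hg := (hasSum_geometric_of_lt_one hq0.le hq1).mul_left
        ((1 + χ) * (1 - q ^ 2) * q ^ 2)
      have h1 : (1 : ℝ) - q ≠ 0 := (sub_pos.2 hq1).ne'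
      rw [show (1 + χ) * (1 - q ^ 2) * q ^ 2 * (1 - q)⁻¹ = (1 + χ) * (1 + q) * q ^ 2 by
        field_simp
        ring] at hg
      refine Eq.mpr (congrArg (fun g : ℕ → ℝ => HasSum g _) (funext fun k => ?_)) hg
      have e1 : (p : ℝ) ^ (-(k + 2) : ℤ) = q ^ (2 * (k + 2)) := by
        rw [hpq, inv_zpow', neg_neg]; norm_cast; rw [← pow_mul]
      have e2 : (p : ℝ) ^ (-(k + 2) - 1 : ℤ) = q ^ (2 * (k + 3)) := by
        rw [show (-(k + 2) - 1 : ℤ) = -(k + 3) by ring, hpq, inv_zpow', neg_neg]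
        norm_cast
        rw [← pow_mul]
      rw [hlevel _ (by omega), e1, e2]
      field_simp
      ring)
  have hmid_eq : ∀ z ∈ {z : ℚ_[p] | ‖z‖ ≤ 1 ∧ ‖(a : ℚ_[p]) * z ^ 2 + (b : ℚ_[p])‖ = 1},
      f z = 1 := fun z hz => by
    simp only [hf]
    rw [hz.2, max_eq_right hz.1]
    simp
  have hmid_int : IntegrableOn f
      {z : ℚ_[p] | ‖z‖ ≤ 1 ∧ ‖(a : ℚ_[p]) * z ^ 2 + (b : ℚ_[p])‖ = 1} μ :=
    (integrableOn_const (hfin _)).congr_fun (fun z hz => (hmid_eq z hz).symm) (hmeas 1)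
  have hmid : ∫ z in {z : ℚ_[p] | ‖z‖ ≤ 1 ∧ ‖(a : ℚ_[p]) * z ^ 2 + (b : ℚ_[p])‖ = 1}, f z ∂μ =
      1 - (1 + χ) * q ^ 2 := by
    rw [setIntegral_congr_fun (hmeas 1) hmid_eq, setIntegral_const, hzero, smul_eq_mul, mul_one]
  rw [setIntegral_union _ ((hmeas 1).union (.iUnion fun k => hmeas _)) hout.1 (hmid_int.union hin.1),
    setIntegral_union _ (.iUnion fun k => hmeas _) hmid_int hin.1, hout.2, hmid, hin.2, hq3, hpq,
    inv_inv]
  · ring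
  · refine Set.disjoint_left.2 fun z hz hz' => ?_
    obtain ⟨k, hk⟩ := Set.mem_iUnion.1 hz'
    have : (p : ℝ) ^ (0 : ℤ) = (p : ℝ) ^ (-(k + 2) : ℤ) := by
      rw [zpow_zero]; exact hz.2.symm.trans hk.2
    have := hinj this
    omega
  · refine Set.disjoint_left.2 fun z hz hz' => ?_
    have h1 := Padic.one_lt_norm_iff.2 (Set.mem_iUnion.1 hz)
    rcases hz' with h | h
    · exact h1.not_ge h.1
    · obtain ⟨k, hk⟩ := Set.mem_iUnion.1 h
      exact h1.not_ge hk.1
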